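/- Let k ≥ 1 and suppose λ ≠ μ are distinct partitions with |λ| = |μ| = k satisfying P_2(λ) = P_2(μ). Then ⟨ s_λ(T), Σ_{i≥1} i³ T_i ∂s_μ(T)/∂T_i ⟩ = 0. -/

import Mathlib

open MvPolynomial

/-- A partition `λ = (λ_1, λ_2, …)`: a non-increasing sequence of non-negative
integers with finitely many nonzero parts.  `parts i` is the part `λ_{i+1}`. -/
structure Ptn where
  parts : ℕ → ℕ
  antitone : ∀ ⦃i j : ℕ⦄, i ≤ j → parts j ≤ parts i
  eventually_zero : ∃ N : ℕ, ∀ i : ℕ, N ≤ i → parts i = 0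

/-- The weight `|λ| = Σ_i λ_i`. -/
noncomputable def Ptn.wt (lam : Ptn) : ℕ := ∑ᶠ i : ℕ, lam.parts i

/-- The length `ℓ(λ)`: the number of nonzero parts. -/
noncomputable def Ptn.len (lam : Ptn) : ℕ := Set.ncard {i : ℕ | lam.parts i ≠ 0}

/-- `P_j(λ) = Σ_{i=1}^{ℓ(λ)} [(λ_i − i + 1/2)^j − (−i + 1/2)^j]`. -/
noncomputable def Pfn (j : ℕ) (lam : Ptn) : ℚ :=
  ∑ᶠ i : ℕ, (((lam.parts i : ℚ) - ((i : ℚ) + 1) + 1 / 2) ^ j - (-((i : ℚ) + 1) + 1 / 2) ^ j)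

/-- The generating series `Σ_{k≥1} T_k z^k / k` (with `T_k = X k`). -/
noncomputable def genT : PowerSeries (MvPolynomial ℕ+ ℂ) :=
  PowerSeries.mk fun m =>
    if h : m = 0 then 0 else ((m : ℂ)⁻¹) • (X (⟨m, Nat.pos_of_ne_zero h⟩ : ℕ+))

/-- The complete homogeneous polynomial `h_k(T)`, defined via
`Σ_{k≥0} h_k(T) z^k = exp(Σ_{k≥1} T_k z^k / k)`. -/
noncomputable def hsym (k : ℕ) : MvPolynomial ℕ+ ℂ :=
  ∑ n ∈ Finset.range (k + 1),
    ((Nat.factorial n : ℂ)⁻¹) • (PowerSeries.coeff (R := MvPolynomial ℕ+ ℂ) k (genT ^ n))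

/-- `h_k` for an integer index, with `h_k := 0` for `k < 0`. -/
noncomputable def hsymZ (z : ℤ) : MvPolynomial ℕ+ ℂ :=
  if 0 ≤ z then hsym z.toNat else 0

/-- The Schur polynomial `s_λ = det(h_{λ_i−i+j})_{1≤i,j≤ℓ(λ)}` (Jacobi–Trudi). -/
noncomputable def schur (lam : Ptn) : MvPolynomial ℕ+ ℂ :=
  (Matrix.of fun i j : Fin lam.len =>
    hsymZ ((lam.parts i : ℤ) - ((i : ℕ) + 1) + ((j : ℕ) + 1))).det

/-- The monomial `T_ν = T_{ν_1} ⋯ T_{ν_{ℓ(ν)}}`. -/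
noncomputable def Tmon (nu : Ptn) : MvPolynomial ℕ+ ℂ :=
  ∏ᶠ i : ℕ, if h : nu.parts i = 0 then 1
    else X (⟨nu.parts i, Nat.pos_of_ne_zero h⟩ : ℕ+)

/-- The multiplicity `m_i(ν)`: the number of parts of `ν` equal to `i`. -/
noncomputable def multPart (nu : Ptn) (i : ℕ) : ℕ := Set.ncard {j : ℕ | nu.parts j = i}

/-- `z_ν = ∏_{i≥1} i^{m_i(ν)} m_i(ν)!`. -/
noncomputable def zPart (nu : Ptn) : ℕ :=
  ∏ᶠ i : ℕ, i ^ multPart nu i * Nat.factorial (multPart nu i)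


noncomputable section S9

abbrev PolyT := MvPolynomial ℕ+ ℂ

/-- the derivation `(n+1) ∂/∂T_{n+1}` -/
def DD (n : ℕ) : Derivation ℂ PolyT PolyT := ((n : ℂ) + 1) • pderiv (Nat.succPNat n)

/-- the Euler derivation -/
def EE : Derivation ℂ PolyT PolyT := mkDerivation ℂ (fun i : ℕ+ => ((i : ℕ) : ℂ) • X i)

lemma coeff_genT_zero : PowerSeries.coeff 0 genT = 0 := by
  simp [genT]

lemma coeff_genT_succ (m : ℕ) : PowerSeries.coeff (m+1) genT =
    (((m : ℂ) + 1)⁻¹) • (X (Nat.succPNat m) : PolyT) := by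
  simp only [genT, PowerSeries.coeff_mk]
  rw [dif_neg (Nat.succ_ne_zero m)]
  push_cast
  rfl

lemma coeff_genT_pow_lt (n k : ℕ) (h : k < n) : PowerSeries.coeff k (genT ^ n) = 0 := by
  apply PowerSeries.coeff_of_lt_order
  refine lt_of_lt_of_le ?_ (PowerSeries.le_order_pow_of_constantCoeff_eq_zero n ?_)
  · exact_mod_cast h
  · rw [← PowerSeries.coeff_zero_eq_constantCoeff_apply]; exact coeff_genT_zero

lemma DD_genT (n k : ℕ) : DD n (PowerSeries.coeff k genT) = if k = n + 1 then 1 else 0 := by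
  rcases k with _ | m
  · simp [coeff_genT_zero]
  · rw [coeff_genT_succ]
    simp only [DD, Derivation.smul_apply, Derivation.map_smul, pderiv_X]
    by_cases h : m = n
    · subst h
      have : ((m : ℂ) + 1) ≠ 0 := by exact_mod_cast Nat.succ_ne_zero m
      simp [smul_smul, this]
    · have h2 : Nat.succPNat m ≠ Nat.succPNat n := fun e => h (Nat.succPNat_injective e)
      simp [Pi.single_apply, h, h2.symm, h2]

lemma EE_genT (k : ℕ) : EE (PowerSeries.coeff k genT) = (k : ℂ) • PowerSeries.coeff k genT := by
  rcases k with _ | m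
  · simp [coeff_genT_zero]
  · rw [coeff_genT_succ]
    simp only [EE, Derivation.map_smul, mkDerivation_X, Nat.succPNat_coe]
    rw [smul_comm]

lemma EE_genT_pow (n k : ℕ) :
    EE (PowerSeries.coeff k (genT ^ n)) = (k : ℂ) • PowerSeries.coeff k (genT ^ n) := by
  induction n generalizing k with
  | zero =>
    rw [pow_zero, PowerSeries.coeff_one]
    split_ifs with h
    · simp [h]
    · simp
  | succ n ih =>
    rw [pow_succ, PowerSeries.coeff_mul, map_sum, Finset.smul_sum]
    refine Finset.sum_congr rfl fun p hp => ?_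
    rw [Finset.HasAntidiagonal.mem_antidiagonal] at hp
    rw [Derivation.leibniz, ih, EE_genT, ← hp]
    simp only [smul_eq_mul, Algebra.smul_def]
    push_cast
    ring

lemma DD_genT_pow (i n k : ℕ) :
    DD i (PowerSeries.coeff k (genT ^ (n+1))) = ((n : ℂ) + 1) •
      PowerSeries.coeff k (genT ^ n * PowerSeries.X ^ (i+1)) := by
  induction n generalizing k with
  | zero =>
    simp [DD_genT, PowerSeries.coeff_X_pow]
  | succ n ih =>
    have key : ∀ k, DD i (PowerSeries.coeff k (genT ^ (n+1) * genT)) =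
        PowerSeries.coeff k (genT ^ (n+1) * PowerSeries.X ^ (i+1)) +
        PowerSeries.coeff k ((PowerSeries.mk fun m => DD i (PowerSeries.coeff m (genT ^ (n+1)))) * genT) := by
      intro k
      rw [PowerSeries.coeff_mul, PowerSeries.coeff_mul, PowerSeries.coeff_mul, map_sum,
        ← Finset.sum_add_distrib]
      refine Finset.sum_congr rfl fun p hp => ?_
      rw [Derivation.leibniz, DD_genT, PowerSeries.coeff_mk, PowerSeries.coeff_X_pow]
      simp only [smul_eq_mul]
      ring
    rw [pow_succ, key]
    have h2 : (PowerSeries.mk fun m => DD i (PowerSeries.coeff m (genT ^ (n+1)))) =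
        ((n : ℂ) + 1) • (genT ^ n * PowerSeries.X ^ (i+1)) := by
      ext1 m
      rw [PowerSeries.coeff_mk, ih]
      rfl
    rw [h2, smul_mul_assoc, mul_right_comm, ← pow_succ]
    have h3 : PowerSeries.coeff k (((n : ℂ) + 1) • (genT ^ (n+1) * PowerSeries.X ^ (i+1))) =
      ((n : ℂ) + 1) • PowerSeries.coeff k (genT ^ (n+1) * PowerSeries.X ^ (i+1)) := rfl
    rw [h3]
    push_cast
    module

lemma EE_hsym (k : ℕ) : EE (hsym k) = (k : ℂ) • hsym k := by
  simp only [hsym, map_sum, Derivation.map_smul, EE_genT_pow, Finset.smul_sum]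
  refine Finset.sum_congr rfl fun n _ => ?_
  rw [smul_comm]

lemma hsym_eq (k M : ℕ) (h : k ≤ M) : hsym k = ∑ n ∈ Finset.range (M + 1),
    ((Nat.factorial n : ℂ)⁻¹) • (PowerSeries.coeff (R := MvPolynomial ℕ+ ℂ) k (genT ^ n)) := by
  unfold hsym
  apply Finset.sum_subset
  · intro x; simp only [Finset.mem_range]; omega
  · intro x _ hx
    simp only [Finset.mem_range] at hx
    rw [coeff_genT_pow_lt _ _ (by omega), smul_zero]

lemma DD_hsym (i k : ℕ) : DD i (hsym k) = if i + 1 ≤ k then hsym (k - (i+1)) else 0 := by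
  rw [hsym_eq k (k+1) (by omega), Finset.sum_range_succ']
  have h0 : DD i (((Nat.factorial 0 : ℂ)⁻¹) • (PowerSeries.coeff (R := MvPolynomial ℕ+ ℂ) k (genT ^ 0))) = 0 := by
    rw [pow_zero, PowerSeries.coeff_one]
    split_ifs <;> simp
  rw [map_add, h0, add_zero, map_sum]
  have h1 : ∀ n ∈ Finset.range (k+1), DD i (((Nat.factorial (n+1) : ℂ)⁻¹) • (PowerSeries.coeff (R := MvPolynomial ℕ+ ℂ) k (genT ^ (n+1)))) = ((Nat.factorial n : ℂ)⁻¹) • PowerSeries.coeff k (genT ^ n * PowerSeries.X ^ (i+1)) := by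
    intro n _
    rw [Derivation.map_smul, DD_genT_pow, smul_smul]
    congr 1
    rw [Nat.factorial_succ]
    have : ((n : ℂ) + 1) ≠ 0 := by exact_mod_cast Nat.succ_ne_zero n
    push_cast
    field_simp
  rw [Finset.sum_congr rfl h1]
  split_ifs with h
  · rw [hsym_eq (k - (i+1)) k (by omega)]
    refine Finset.sum_congr rfl fun n _ => ?_
    rw [PowerSeries.coeff_mul_X_pow', if_pos h]
  · refine Finset.sum_eq_zero fun n _ => ?_
    rw [PowerSeries.coeff_mul_X_pow', if_neg h, smul_zero]

lemma EE_hsymZ (z : ℤ) : EE (hsymZ z) = (z : ℂ) • hsymZ z := by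
  unfold hsymZ
  split_ifs with h
  · rw [EE_hsym]
    congr 1
    exact_mod_cast congrArg (Int.cast : ℤ → ℂ) (Int.toNat_of_nonneg h)
  · simp

lemma DD_hsymZ (i : ℕ) (z : ℤ) : DD i (hsymZ z) = hsymZ (z - (i + 1)) := by
  unfold hsymZ
  by_cases h : 0 ≤ z
  · rw [if_pos h, DD_hsym]
    by_cases h2 : i + 1 ≤ z.toNat
    · rw [if_pos h2, if_pos (by omega)]
      congr 1; omega
    · rw [if_neg h2, if_neg (by omega)]
  · rw [if_neg h, if_neg (by omega), map_zero]

lemma hsym_zero : hsym 0 = 1 := by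
  simp [hsym]

lemma constCoeff_hsymZ (z : ℤ) : constantCoeff (hsymZ z) = if z = 0 then 1 else 0 := by
  by_cases h : z = 0
  · subst h; simp [hsymZ, hsym_zero]
  · rw [if_neg h]
    have h1 := congrArg constantCoeff (EE_hsymZ z)
    have h2 : ∀ f : PolyT, constantCoeff (EE f) = 0 := by
      intro f
      induction f using MvPolynomial.induction_on with
      | C a => simp
      | add p q hp hq => simp [hp, hq]
      | mul_X p n hp =>
        rw [Derivation.leibniz]
        simp [EE, mkDerivation_X]
    rw [h2, constantCoeff_smul] at h1
    have h3 : (z : ℂ) ≠ 0 := by exact_mod_cast h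
    have := h1.symm
    simpa [h3] using this

open Equiv in
/-- generalized Schur determinant -/
def SS {N : ℕ} (l : Fin N → ℤ) : PolyT :=
  ∑ σ : Perm (Fin N), ((Perm.sign σ : ℤ) : ℂ) • ∏ r, hsymZ (l r - ((N : ℤ) - 1) + (σ r : ℕ))

lemma deriv_prod {ι : Type*} [DecidableEq ι] (D : Derivation ℂ PolyT PolyT) (s : Finset ι)
    (f : ι → PolyT) : D (∏ r ∈ s, f r) = ∑ r ∈ s, (∏ x ∈ s.erase r, f x) * D (f r) := by
  induction s using Finset.induction_on with
  | empty => simp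
  | insert a s ha ih =>
    rw [Finset.prod_insert ha, Derivation.leibniz, ih, Finset.sum_insert ha,
      Finset.erase_insert ha, smul_eq_mul, smul_eq_mul, Finset.mul_sum, add_comm]
    congr 1
    refine Finset.sum_congr rfl fun r hr => ?_
    have hra : a ≠ r := fun h => ha (h ▸ hr)
    rw [Finset.erase_insert_of_ne hra, Finset.prod_insert (by simp [ha])]
    ring

lemma DD_SS {N : ℕ} (l : Fin N → ℤ) (i : ℕ) :
    DD i (SS l) = ∑ r, SS (Function.update l r (l r - (i + 1))) := by
  unfold SS
  rw [Finset.sum_comm, map_sum]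
  refine Finset.sum_congr rfl fun σ _ => ?_
  rw [Derivation.map_smul, deriv_prod, Finset.smul_sum]
  refine Finset.sum_congr rfl fun r _ => ?_
  congr 1
  rw [← Finset.mul_prod_erase _ _ (Finset.mem_univ r), mul_comm]
  congr 1
  · rw [DD_hsymZ, Function.update_self]
    congr 1; ring
  · refine Finset.prod_congr rfl fun x hx => ?_
    rw [Function.update_of_ne (Finset.ne_of_mem_erase hx)]

/-- degree -/
def dg {N : ℕ} (l : Fin N → ℤ) : ℤ := ∑ r, l r - ∑ r : Fin N, ((r : ℕ) : ℤ)

lemma two_tri (N : ℕ) : 2 * ∑ r : Fin N, ((r : ℕ) : ℤ) = N * ((N : ℤ) - 1) := by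
  induction N with
  | zero => simp
  | succ n ih => rw [Fin.sum_univ_castSucc]; simp only [Fin.val_castSucc, Fin.val_last, mul_add, ih]; push_cast; ring

lemma EE_SS {N : ℕ} (l : Fin N → ℤ) : EE (SS l) = (dg l : ℂ) • SS l := by
  unfold SS
  rw [map_sum, Finset.smul_sum]
  refine Finset.sum_congr rfl fun σ _ => ?_
  rw [Derivation.map_smul, deriv_prod, smul_comm]
  congr 1
  have h : ∀ r ∈ (Finset.univ : Finset (Fin N)), (∏ x ∈ Finset.univ.erase r, hsymZ (l x - ((N : ℤ) - 1) + (σ x : ℕ))) *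
      EE (hsymZ (l r - ((N : ℤ) - 1) + (σ r : ℕ))) = ((l r - ((N : ℤ) - 1) + (σ r : ℕ) : ℤ) : ℂ) •
      ∏ x, hsymZ (l x - ((N : ℤ) - 1) + (σ x : ℕ)) := by
    intro r _
    rw [EE_hsymZ, mul_smul_comm, Finset.prod_erase_mul _ _ (Finset.mem_univ r)]
  rw [Finset.sum_congr rfl h, ← Finset.sum_smul, ← Int.cast_sum]
  congr 2
  rw [Finset.sum_add_distrib, Finset.sum_sub_distrib, Equiv.sum_comp σ (fun j : Fin N => ((j : ℕ) : ℤ))]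
  have := two_tri N
  simp only [Finset.sum_const, Finset.card_univ, Fintype.card_fin, nsmul_eq_mul, dg]
  linarith

lemma coeff_EE (f : PolyT) (m : ℕ+ →₀ ℕ) :
    coeff m (EE f) = ((m.sum fun i k => (i : ℕ) * k : ℕ) : ℂ) * coeff m f := by
  induction f using MvPolynomial.induction_on' with
  | add p q hp hq => rw [map_add, coeff_add, hp, hq, coeff_add]; ring
  | monomial u a =>
    have : EE (monomial u a) = ((u.sum fun i k => (i : ℕ) * k : ℕ) : ℂ) • monomial u a := by
      rw [EE, mkDerivation_monomial, Finsupp.sum, Finsupp.sum, Nat.cast_sum, Finset.sum_smul, Finset.smul_sum]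
      refine Finset.sum_congr rfl fun i hi => ?_
      have h1 : 1 ≤ u i := Nat.one_le_iff_ne_zero.mpr (Finsupp.mem_support_iff.mp hi)
      have h2 : u - Finsupp.single i 1 + Finsupp.single i 1 = u := by
        apply tsub_add_cancel_of_le
        simpa using h1
      rw [X, smul_eq_mul, mul_smul_comm, monomial_mul, h2, mul_one]
      simp only [smul_monomial]
      congr 1
      simp only [smul_eq_mul]; push_cast; ring
    rw [this, coeff_smul, smul_eq_mul, coeff_monomial]
    split_ifs with h
    · rw [h]
    · simp

lemma SS_coeff {N : ℕ} (l : Fin N → ℤ) (m : ℕ+ →₀ ℕ) (h : ((m.sum fun i k => (i : ℕ) * k : ℕ) : ℤ) ≠ dg l) :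
    coeff m (SS l) = 0 := by
  have h1 := coeff_EE (SS l) m
  rw [EE_SS, coeff_smul, smul_eq_mul, ← sub_eq_zero, ← sub_mul] at h1
  rcases mul_eq_zero.mp h1 with h2 | h2
  · exfalso; apply h
    rw [sub_eq_zero] at h2
    exact_mod_cast h2.symm
  · exact h2

lemma SS_neg {N : ℕ} (l : Fin N → ℤ) (h : dg l < 0) : SS l = 0 := by
  ext m
  rw [SS_coeff l m (by omega), coeff_zero]

lemma SS_const {N : ℕ} (l : Fin N → ℤ) (h : dg l = 0) : SS l = C (constantCoeff (SS l)) := by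
  ext m
  by_cases hm : m = 0
  · subst hm; simp [constantCoeff_eq]
  · rw [SS_coeff l m, coeff_C, if_neg (Ne.symm hm)]
    rw [h]
    obtain ⟨i, hi⟩ := Finsupp.ne_iff.mp hm
    have hi' : i ∈ m.support := Finsupp.mem_support_iff.mpr hi
    have : (i : ℕ) * m i ≤ m.sum fun i k => (i : ℕ) * k :=
      Finset.single_le_sum (f := fun i : ℕ+ => (i : ℕ) * m i) (fun _ _ => Nat.zero_le _) hi'
    have h3 : 0 < (i : ℕ) * m i := Nat.mul_pos i.pos (Nat.pos_of_ne_zero hi)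
    omega

lemma constCoeff_SS {N : ℕ} (l : Fin N → ℤ) : constantCoeff (SS l) =
    (Matrix.of fun r j : Fin N => if l r - ((N : ℤ) - 1) + (j : ℕ) = 0 then (1 : ℂ) else 0).det := by
  rw [← Matrix.det_transpose, Matrix.det_apply']
  unfold SS
  rw [map_sum]
  refine Finset.sum_congr rfl fun σ _ => ?_
  rw [constantCoeff_smul, map_prod]
  simp only [constCoeff_hsymZ, smul_eq_mul, Matrix.transpose_apply, Matrix.of_apply]


def dl (a b : ℤ) : ℂ := if a = b ∧ 0 ≤ a then 1 else 0

open Equiv in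
def GG {N : ℕ} (l l' : Fin N → ℤ) : ℂ :=
  ∑ σ : Perm (Fin N), ((Perm.sign σ : ℤ) : ℂ) * ∏ r, dl (l r) (l' (σ r))

lemma GG_det {N : ℕ} (l l' : Fin N → ℤ) : GG l l' = (Matrix.of fun r t => dl (l r) (l' t)).det := by
  rw [← Matrix.det_transpose, Matrix.det_apply']
  rfl

lemma prod_upd_same {N : ℕ} (l l' : Fin N → ℤ) (σ : Equiv.Perm (Fin N)) (r : Fin N) (a b : ℤ) :
    ∏ x, dl (Function.update l r a x) (Function.update l' (σ r) b (σ x)) =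
      dl a b * ∏ x ∈ Finset.univ.erase r, dl (l x) (l' (σ x)) := by
  rw [← Finset.mul_prod_erase _ _ (Finset.mem_univ r)]
  simp only [Function.update_self]
  congr 1
  refine Finset.prod_congr rfl fun x hx => ?_
  have hx' := Finset.ne_of_mem_erase hx
  rw [Function.update_of_ne hx', Function.update_of_ne (σ.injective.ne hx')]

lemma prod_upd_diff {N : ℕ} (l l' : Fin N → ℤ) (σ : Equiv.Perm (Fin N)) (r r' : Fin N) (hr : r ≠ r') (a b : ℤ) :
    ∏ x, dl (Function.update l r a x) (Function.update l' (σ r') b (σ x)) =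
      (dl a (l' (σ r)) * dl (l r') b) * ∏ x ∈ (Finset.univ.erase r).erase r', dl (l x) (l' (σ x)) := by
  rw [← Finset.mul_prod_erase _ _ (Finset.mem_univ r),
    ← Finset.mul_prod_erase (Finset.univ.erase r) _ (a := r') (by simp [hr.symm]), ← mul_assoc]
  rw [Function.update_self, Function.update_of_ne (σ.injective.ne hr), Function.update_of_ne hr.symm, Function.update_self]
  congr 1
  refine Finset.prod_congr rfl fun x hx => ?_
  have hx' := Finset.ne_of_mem_erase hx
  have hx2 := Finset.ne_of_mem_erase (Finset.mem_of_mem_erase hx)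
  rw [Function.update_of_ne hx2, Function.update_of_ne (σ.injective.ne hx')]

def AA {N : ℕ} (l l' : Fin N → ℤ) (r r' : Fin N) (ψ : ℤ → ℤ → ℤ → ℤ → ℂ) : ℂ :=
  ∑ σ : Equiv.Perm (Fin N), ((Equiv.Perm.sign σ : ℤ) : ℂ) *
    (ψ (l r) (l r') (l' (σ r)) (l' (σ r')) * ∏ x ∈ (Finset.univ.erase r).erase r', dl (l x) (l' (σ x)))

lemma AA_anti {N : ℕ} (l l' : Fin N → ℤ) (r r' : Fin N) (hr : r ≠ r') (ψ : ℤ → ℤ → ℤ → ℤ → ℂ) :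
    AA l l' r r' ψ = - AA l l' r r' (fun a a' b b' => ψ a a' b' b) := by
  unfold AA
  rw [← Equiv.sum_comp (Equiv.mulRight (Equiv.swap r r')), ← Finset.sum_neg_distrib]
  refine Finset.sum_congr rfl fun σ _ => ?_
  simp only [Equiv.coe_mulRight, Equiv.Perm.sign_mul, Equiv.Perm.sign_swap hr, Equiv.Perm.mul_apply,
    Equiv.swap_apply_left, Equiv.swap_apply_right]
  have : ∏ x ∈ (Finset.univ.erase r).erase r', dl (l x) (l' (σ (Equiv.swap r r' x))) =
      ∏ x ∈ (Finset.univ.erase r).erase r', dl (l x) (l' (σ x)) := by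
    refine Finset.prod_congr rfl fun x hx => ?_
    rw [Equiv.swap_apply_of_ne_of_ne (Finset.ne_of_mem_erase (Finset.mem_of_mem_erase hx)) (Finset.ne_of_mem_erase hx)]
  rw [this]
  push_cast
  ring

lemma AA_add {N : ℕ} (l l' : Fin N → ℤ) (r r' : Fin N) (ψ χ : ℤ → ℤ → ℤ → ℤ → ℂ) :
    AA l l' r r' ψ + AA l l' r r' χ = AA l l' r r' (fun a a' b b' => ψ a a' b b' + χ a a' b b') := by
  unfold AA
  rw [← Finset.sum_add_distrib]
  refine Finset.sum_congr rfl fun σ _ => ?_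
  ring

lemma AA_swap {N : ℕ} (l l' : Fin N → ℤ) (r r' : Fin N) (ψ : ℤ → ℤ → ℤ → ℤ → ℂ) :
    AA l l' r' r ψ = AA l l' r r' (fun a a' b b' => ψ a' a b' b) := by
  unfold AA
  refine Finset.sum_congr rfl fun σ _ => ?_
  rw [Finset.erase_right_comm]

lemma AA_neg {N : ℕ} (l l' : Fin N → ℤ) (r r' : Fin N) (ψ : ℤ → ℤ → ℤ → ℤ → ℂ) :
    - AA l l' r r' ψ = AA l l' r r' (fun a a' b b' => - ψ a a' b b') := by
  unfold AA
  rw [← Finset.sum_neg_distrib]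
  refine Finset.sum_congr rfl fun σ _ => ?_
  ring

lemma AA_GG {N : ℕ} (l l' : Fin N → ℤ) (r r' : Fin N) (hr : r ≠ r') :
    AA l l' r r' (fun a a' b b' => dl a b * dl a' b') = GG l l' := by
  unfold AA GG
  refine Finset.sum_congr rfl fun σ _ => ?_
  congr 1
  rw [← Finset.mul_prod_erase _ (fun x => dl (l x) (l' (σ x))) (Finset.mem_univ r),
    ← Finset.mul_prod_erase (Finset.univ.erase r) _ (a := r') (by simp [hr.symm]), ← mul_assoc]

def phi (a a' b b' : ℤ) : ℂ := if a + a' = b + b' ∧ b < a ∧ 0 ≤ b ∧ 0 ≤ a' then 1 else 0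

lemma phi_key (a a' b b' : ℤ) :
    (phi a a' b b' + phi a' a b' b) + -(phi a a' b' b + phi a' a b b') =
      -(dl a b * dl a' b') + (dl a b' * dl a' b) := by
  unfold phi dl
  split_ifs <;> first | (exfalso; omega) | norm_num

lemma AA_phi {N : ℕ} (l l' : Fin N → ℤ) (r r' : Fin N) (hr : r ≠ r') :
    AA l l' r r' phi + AA l l' r' r phi = - GG l l' := by
  have h1 : AA l l' r r' phi + AA l l' r' r phi =
      AA l l' r r' (fun a a' b b' => phi a a' b b' + phi a' a b' b) := by
    rw [AA_swap l l' r r', AA_add]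
  have h2 := AA_anti l l' r r' hr (fun a a' b b' => phi a a' b b' + phi a' a b' b)
  have h3 := AA_anti l l' r r' hr (fun a a' b b' => dl a b * dl a' b')
  rw [AA_GG _ _ _ _ hr] at h3
  have h4 : AA l l' r r' (fun a a' b b' => phi a a' b b' + phi a' a b' b) +
     - AA l l' r r' (fun a a' b b' => phi a a' b' b + phi a' a b b') =
     - AA l l' r r' (fun a a' b b' => dl a b * dl a' b') + AA l l' r r' (fun a a' b b' => dl a b' * dl a' b) := by
    rw [AA_neg, AA_neg, AA_add, AA_add]
    congr 1
    funext a a' b b'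
    exact phi_key a a' b b'
  rw [AA_GG _ _ _ _ hr] at h4
  rw [h1]
  linear_combination (1/2) * h4 + (1/2) * h2 + (1/2) * h3

lemma sum_dl_same (a b : ℤ) (M : ℕ) (hM : a ≤ M) :
    ∑ i ∈ Finset.range M, dl (a - (i + 1)) (b - (i + 1)) = (a : ℂ) * dl a b := by
  by_cases hab : a = b
  · subst hab
    by_cases h0 : 0 ≤ a
    · obtain ⟨n, rfl⟩ := Int.eq_ofNat_of_zero_le h0
      have hn : n ≤ M := by exact_mod_cast hM
      have : ∀ i ∈ Finset.range M, dl ((n : ℤ) - (i + 1)) ((n : ℤ) - (i + 1)) = if i < n then 1 else 0 := by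
        intro i _
        unfold dl
        by_cases h : i < n
        · rw [if_pos h, if_pos ⟨rfl, by omega⟩]
        · rw [if_neg h, if_neg (by omega)]
      rw [Finset.sum_congr rfl this, ← Finset.sum_filter, Finset.sum_const]
      have h2 : (Finset.range M).filter (fun i => i < n) = Finset.range n := by
        ext i; simp; omega
      rw [h2]
      simp [dl]
    · rw [dl, if_neg (by omega), mul_zero]
      refine Finset.sum_eq_zero fun i _ => ?_
      rw [dl, if_neg (by omega)]
  · rw [dl, if_neg (by omega), mul_zero]
    refine Finset.sum_eq_zero fun i _ => ?_
    rw [dl, if_neg (by omega)]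

lemma sum_dl_diff (a a' b b' : ℤ) (M : ℕ) (hM : a ≤ M) :
    ∑ i ∈ Finset.range M, dl (a - (i + 1)) b * dl a' (b' - (i + 1)) = phi a a' b b' := by
  unfold phi
  split_ifs with h
  · rw [Finset.sum_eq_single (a - b - 1).toNat]
    · unfold dl
      rw [if_pos (by omega), if_pos (by omega), mul_one]
    · intro i _ hi
      unfold dl
      rw [if_neg (by omega), zero_mul]
    · intro hh
      rw [Finset.mem_range] at hh
      omega
  · refine Finset.sum_eq_zero fun i _ => ?_
    unfold dl
    by_cases h1 : (a - (i + 1) = b ∧ 0 ≤ a - ((i : ℤ) + 1))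
    · rw [if_neg (c := (a' = b' - ((i : ℤ) + 1) ∧ 0 ≤ a')) (by omega), mul_zero]
    · rw [if_neg h1, zero_mul]

lemma GG_rec {N : ℕ} (l l' : Fin N → ℤ) (M : ℕ) (hM : ∀ r, l r ≤ M) :
    ∑ i ∈ Finset.range M, ∑ r, ∑ t, GG (Function.update l r (l r - (i + 1)))
      (Function.update l' t (l' t - (i + 1))) = (dg l : ℂ) * GG l l' := by
  have step : ∀ r, ∑ i ∈ Finset.range M, ∑ t, GG (Function.update l r (l r - (i + 1)))
      (Function.update l' t (l' t - (i + 1))) = (l r : ℂ) * GG l l' + ∑ r' ∈ Finset.univ.erase r, AA l l' r r' phi := by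
    intro r
    have e1 : ∀ i : ℕ, ∑ t, GG (Function.update l r (l r - (i + 1)))
      (Function.update l' t (l' t - (i + 1))) = ∑ σ : Equiv.Perm (Fin N), ((Equiv.Perm.sign σ : ℤ) : ℂ) *
       ∑ r', ∏ x, dl (Function.update l r (l r - (i + 1)) x) (Function.update l' (σ r') (l' (σ r') - (i + 1)) (σ x)) := by
      intro i
      unfold GG
      rw [Finset.sum_comm]
      refine Finset.sum_congr rfl fun σ _ => ?_
      rw [← Finset.mul_sum]
      congr 1
      exact (Equiv.sum_comp σ (fun t => ∏ x, dl (Function.update l r (l r - (i + 1)) x) (Function.update l' t (l' t - (i + 1)) (σ x)))).symm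
    simp only [e1]
    rw [Finset.sum_comm]
    unfold AA GG
    rw [Finset.sum_comm (s := Finset.univ.erase r), Finset.mul_sum, ← Finset.sum_add_distrib]
    refine Finset.sum_congr rfl fun σ _ => ?_
    rw [← Finset.mul_sum, ← Finset.mul_sum, mul_left_comm, ← mul_add]
    congr 1
    rw [Finset.sum_comm, ← Finset.add_sum_erase _ _ (Finset.mem_univ r)]
    congr 1
    · simp only [prod_upd_same]
      rw [← Finset.sum_mul, sum_dl_same _ _ _ (hM r), mul_assoc,
        Finset.mul_prod_erase _ (fun x => dl (l x) (l' (σ x))) (Finset.mem_univ r)]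
    · refine Finset.sum_congr rfl fun r' hr' => ?_
      have hne := Finset.ne_of_mem_erase hr'
      simp only [prod_upd_diff l l' σ r r' hne.symm]
      rw [← Finset.sum_mul, sum_dl_diff _ _ _ _ _ (hM r)]
  rw [Finset.sum_comm]
  rw [Finset.sum_congr rfl fun r _ => step r, Finset.sum_add_distrib, ← Finset.sum_mul]
  have h2 : 2 * ∑ r : Fin N, ∑ r' ∈ Finset.univ.erase r, AA l l' r r' phi = - ((N * ((N : ℤ) - 1) : ℤ) : ℂ) * GG l l' := by
    have hsw : ∑ r : Fin N, ∑ r' ∈ Finset.univ.erase r, AA l l' r r' phi = ∑ r : Fin N, ∑ r' ∈ Finset.univ.erase r, AA l l' r' r phi := by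
      apply Finset.sum_comm'
      intro x y
      simp [eq_comm]
    rw [two_mul]
    nth_rewrite 2 [hsw]
    rw [← Finset.sum_add_distrib]
    have : ∀ r : Fin N, (∑ r' ∈ Finset.univ.erase r, AA l l' r r' phi + ∑ r' ∈ Finset.univ.erase r, AA l l' r' r phi) = - ((N : ℂ) - 1) * GG l l' := by
      intro r
      rw [← Finset.sum_add_distrib, Finset.sum_congr rfl fun r' hr' => AA_phi l l' r r' (Finset.ne_of_mem_erase hr').symm]
      rw [Finset.sum_const, Finset.card_erase_of_mem (Finset.mem_univ r), Finset.card_univ, Fintype.card_fin, nsmul_eq_mul]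
      have : 1 ≤ N := by have := r.2; omega
      push_cast [this]
      ring
    rw [Finset.sum_congr rfl fun r _ => this r, Finset.sum_const, Finset.card_univ, Fintype.card_fin, nsmul_eq_mul]
    push_cast
    ring
  rw [← two_tri] at h2
  unfold dg
  push_cast at h2 ⊢
  linear_combination (1/2) * h2


/-- tail counts -/
def cc (s : ℕ+ →₀ ℕ) (m : ℕ) : ℕ := ∑ i ∈ s.support.filter (fun i : ℕ+ => m ≤ (i : ℕ)), s i

lemma cc_zero (s : ℕ+ →₀ ℕ) : ∃ m, ∀ k, m ≤ k → cc s k = 0 := by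
  refine ⟨s.support.sup (fun i => (i : ℕ)) + 1, fun k hk => ?_⟩
  unfold cc
  rw [Finset.filter_false_of_mem, Finset.sum_empty]
  intro i hi h
  have := Finset.le_sup (f := fun i : ℕ+ => (i : ℕ)) hi
  omega

lemma cc_ex (s : ℕ+ →₀ ℕ) (j : ℕ) : ∃ m, cc s (m + 1) ≤ j := by
  obtain ⟨m, hm⟩ := cc_zero s
  exact ⟨m, by rw [hm _ (by omega)]; omega⟩

lemma cc_anti (s : ℕ+ →₀ ℕ) {m n : ℕ} (h : m ≤ n) : cc s n ≤ cc s m := by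
  unfold cc
  apply Finset.sum_le_sum_of_subset
  intro i
  simp only [Finset.mem_filter]
  rintro ⟨h1, h2⟩
  exact ⟨h1, by omega⟩

lemma cc_succ (s : ℕ+ →₀ ℕ) (i : ℕ+) : cc s i = cc s (i + 1) + s i := by
  unfold cc
  rw [Finset.sum_filter, Finset.sum_filter]
  have h : s i = ∑ j ∈ s.support, if j = i then s j else 0 := by
    rw [Finset.sum_ite_eq']
    split_ifs with h
    · rfl
    · exact Finsupp.notMem_support_iff.mp h
  conv_rhs => rw [h]
  rw [← Finset.sum_add_distrib]
  refine Finset.sum_congr rfl fun j _ => ?_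
  by_cases hji : j = i
  · subst hji; simp
  · have : (j : ℕ) ≠ i := fun h => hji (PNat.coe_injective h)
    by_cases h2 : (i : ℕ) ≤ j
    · rw [if_pos h2, if_pos (by omega), if_neg hji, add_zero]
    · rw [if_neg h2, if_neg (by omega), if_neg hji, add_zero]

open Classical in
def ptnOf (s : ℕ+ →₀ ℕ) : Ptn where
  parts j := Nat.find (cc_ex s j)
  antitone := by
    intro i j hij
    apply Nat.find_mono
    intro n hn
    omega
  eventually_zero := by
    refine ⟨cc s 1, fun i hi => ?_⟩
    rw [Nat.find_eq_zero]
    exact hi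

lemma ptnOf_parts (s : ℕ+ →₀ ℕ) (i : ℕ+) (j : ℕ) :
    (ptnOf s).parts j = i ↔ cc s (i + 1) ≤ j ∧ j < cc s i := by
  classical
  have : (ptnOf s).parts j = i ↔ (cc s (i+1) ≤ j ∧ ∀ n < (i : ℕ), ¬ cc s (n+1) ≤ j) := by
    unfold ptnOf
    simp only
    rw [Nat.find_eq_iff]
  rw [this]
  refine and_congr_right fun _ => ⟨fun h => ?_, fun h n hn => ?_⟩
  · have := h (i - 1) (by have := i.pos; omega)
    have e : (i : ℕ) - 1 + 1 = i := by have := i.pos; omega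
    rw [e] at this; omega
  · have := cc_anti s (m := n+1) (n := i) hn
    omega

lemma mult_ptnOf (s : ℕ+ →₀ ℕ) (i : ℕ+) : multPart (ptnOf s) i = s i := by
  unfold multPart
  have : {j : ℕ | (ptnOf s).parts j = i} = ((Finset.Ico (cc s (i+1)) (cc s i) : Finset ℕ) : Set ℕ) := by
    ext j
    simp [ptnOf_parts]
  rw [this, Set.ncard_coe_finset, Nat.card_Ico, cc_succ]
  omega

lemma mult_zero (nu : Ptn) : multPart nu 0 = 0 := by
  unfold multPart
  apply Set.Infinite.ncard
  obtain ⟨N, hN⟩ := nu.eventually_zero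
  exact (Set.Ici_infinite N).mono fun i hi => hN i hi

def gexp (n : ℕ) : ℕ+ →₀ ℕ := if n = 0 then 0 else Finsupp.single (Nat.toPNat' n) 1

lemma gexp_eq (n : ℕ) : (if h : n = 0 then (1 : PolyT) else X (⟨n, Nat.pos_of_ne_zero h⟩ : ℕ+)) =
    monomial (gexp n) (1 : ℂ) := by
  unfold gexp
  by_cases h : n = 0
  · rw [dif_pos h, if_pos h]; rfl
  · rw [dif_neg h, if_neg h]
    have : (⟨n, Nat.pos_of_ne_zero h⟩ : ℕ+) = Nat.toPNat' n := by
      apply PNat.coe_injective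
      rw [Nat.toPNat'_coe, if_pos (Nat.pos_of_ne_zero h)]; rfl
    exact congrArg X this

lemma Tmon_ptnOf (s : ℕ+ →₀ ℕ) : Tmon (ptnOf s) = monomial s 1 := by
  classical
  obtain ⟨N, hN⟩ := (ptnOf s).eventually_zero
  have hT : Tmon (ptnOf s) = ∏ᶠ j : ℕ, (monomial (gexp ((ptnOf s).parts j)) (1 : ℂ) : PolyT) :=
    finprod_congr fun j => gexp_eq _
  rw [hT, finprod_eq_prod_of_mulSupport_subset (s := Finset.range N)]
  · rw [← monomial_sum_one]
    refine congrArg (fun u : ℕ+ →₀ ℕ => (monomial u (1 : ℂ) : PolyT)) ?_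
    refine Finsupp.ext fun i => ?_
    rw [Finsupp.finset_sum_apply, ← mult_ptnOf s i]
    unfold multPart
    have h1 : {j : ℕ | (ptnOf s).parts j = i} = (((Finset.range N).filter fun j => (ptnOf s).parts j = i : Finset ℕ) : Set ℕ) := by
      ext j
      simp only [Set.mem_setOf_eq, Finset.coe_filter, Finset.mem_range]
      refine ⟨fun h => ⟨?_, h⟩, fun h => h.2⟩
      by_contra hc
      have := hN j (by omega)
      have := i.pos
      omega
    rw [h1, Set.ncard_coe_finset, Finset.card_filter]
    refine Finset.sum_congr rfl fun j _ => ?_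
    by_cases h : (ptnOf s).parts j = 0
    · rw [gexp, if_pos h, if_neg (by have := i.pos; omega)]; rfl
    · rw [gexp, if_neg h, Finsupp.single_apply]
      congr 1
      rw [← PNat.coe_inj, Nat.toPNat'_coe, if_pos (Nat.pos_of_ne_zero h)]
  · intro j hj
    rw [Function.mem_mulSupport] at hj
    by_contra hc
    simp only [Finset.coe_range, Set.mem_Iio, not_lt] at hc
    apply hj
    rw [hN j hc, gexp, if_pos rfl]; rfl

def zz (s : ℕ+ →₀ ℕ) : ℂ := ∏ i ∈ s.support, (((i : ℕ) : ℂ) ^ s i * (Nat.factorial (s i) : ℂ))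

lemma zPart_ptnOf (s : ℕ+ →₀ ℕ) : ((zPart (ptnOf s) : ℕ) : ℂ) = zz s := by
  unfold zPart zz
  have hm : ∀ i : ℕ, i ∉ s.support.map ⟨((↑) : ℕ+ → ℕ), PNat.coe_injective⟩ → multPart (ptnOf s) i = 0 := by
    intro i hi
    rcases Nat.eq_zero_or_pos i with h | h
    · subst h; exact mult_zero _
    · have := mult_ptnOf s ⟨i, h⟩
      simp only [PNat.mk_coe] at this
      rw [this]
      by_contra hc
      apply hi
      rw [Finset.mem_map]
      exact ⟨⟨i, h⟩, Finsupp.mem_support_iff.mpr hc, rfl⟩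
  rw [finprod_eq_prod_of_mulSupport_subset (s := s.support.map ⟨((↑) : ℕ+ → ℕ), PNat.coe_injective⟩)]
  · rw [Finset.prod_map, Nat.cast_prod]
    refine Finset.prod_congr rfl fun i _ => ?_
    simp only [Function.Embedding.coeFn_mk, mult_ptnOf]
    push_cast
    rfl
  · intro i hi
    by_contra hc
    rw [Function.mem_mulSupport] at hi
    apply hi
    rw [hm i hc]; simp

lemma zz_add (s : ℕ+ →₀ ℕ) (i : ℕ+) : zz (s + Finsupp.single i 1) = ((i : ℕ) : ℂ) * ((s i : ℂ) + 1) * zz s := by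
  classical
  have h : ∀ (t : ℕ+ →₀ ℕ) (S : Finset ℕ+), t.support ⊆ S → zz t = ∏ i ∈ S, (((i : ℕ) : ℂ) ^ t i * (Nat.factorial (t i) : ℂ)) := by
    intro t S hS
    apply Finset.prod_subset hS
    intro x _ hx
    rw [Finsupp.notMem_support_iff.mp hx]; simp
  rw [h (s + Finsupp.single i 1) (insert i s.support), h s (insert i s.support) (Finset.subset_insert _ _)]
  · rw [← Finset.mul_prod_erase _ _ (Finset.mem_insert_self i s.support),
      ← Finset.mul_prod_erase _ (fun i : ℕ+ => (((i : ℕ) : ℂ) ^ s i * (Nat.factorial (s i) : ℂ))) (Finset.mem_insert_self i s.support), ← mul_assoc]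
    congr 1
    · simp only [Finsupp.add_apply, Finsupp.single_eq_same, Nat.factorial_succ, pow_succ]
      push_cast; ring
    · refine Finset.prod_congr rfl fun x hx => ?_
      rw [Finsupp.add_apply, Finsupp.single_eq_of_ne (Finset.ne_of_mem_erase hx), add_zero]
  · intro x hx
    rw [Finset.mem_insert]
    by_cases hxi : x = i
    · exact Or.inl hxi
    · right
      rw [Finsupp.mem_support_iff] at hx ⊢
      rwa [Finsupp.add_apply, Finsupp.single_eq_of_ne hxi, add_zero] at hx

section form
open Classical in
/-- the hypothesis -/
def IsForm (B : PolyT →ₗ[ℂ] PolyT →ₗ[ℂ] ℂ) : Prop := ∀ nu rho : Ptn,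
      B (Tmon nu) (Tmon rho) = if nu = rho then ((zPart nu : ℕ) : ℂ) else 0

lemma B_mono {B : PolyT →ₗ[ℂ] PolyT →ₗ[ℂ] ℂ} (hB : IsForm B) (s t : ℕ+ →₀ ℕ) :
    B (monomial s 1) (monomial t 1) = if s = t then zz s else 0 := by
  classical
  rw [← Tmon_ptnOf, ← Tmon_ptnOf, hB]
  by_cases h : s = t
  · subst h; simp [zPart_ptnOf]
  · rw [if_neg h, if_neg]
    intro e
    apply h
    ext i
    rw [← mult_ptnOf s, ← mult_ptnOf t, e]

lemma B_adj {B : PolyT →ₗ[ℂ] PolyT →ₗ[ℂ] ℂ} (hB : IsForm B) (i : ℕ) (f g : PolyT) :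
    B f (X (Nat.succPNat i) * g) = B (DD i f) g := by
  classical
  induction f using MvPolynomial.induction_on' with
  | add p q hp hq => simp only [map_add, LinearMap.add_apply, hp, hq]
  | monomial s a =>
  induction g using MvPolynomial.induction_on' with
  | add p q hp hq => rw [mul_add, map_add, map_add, hp, hq]
  | monomial t b =>
    have ha : ∀ (u : ℕ+ →₀ ℕ) (c : ℂ), (monomial u c : PolyT) = c • monomial u 1 := by
      intro u c; rw [smul_monomial, smul_eq_mul, mul_one]
    have h1 : (X (Nat.succPNat i) : PolyT) * monomial t b = b • monomial (t + Finsupp.single (Nat.succPNat i) 1) 1 := by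
      rw [X, monomial_mul, one_mul, add_comm, ha]
    have h2 : DD i (monomial s a) = (((i : ℂ) + 1) * (a * s (Nat.succPNat i))) • monomial (s - Finsupp.single (Nat.succPNat i) 1) 1 := by
      rw [DD, Derivation.smul_apply, pderiv_monomial, ha, smul_smul]
    rw [h1, h2, ha s a, ha t b]
    simp only [map_smul, LinearMap.smul_apply, B_mono hB, smul_eq_mul]
    set e := Nat.succPNat i with he
    by_cases hst : s = t + Finsupp.single e 1
    · have h3 : s - Finsupp.single e 1 = t := by rw [hst, add_tsub_cancel_right]
      rw [if_pos hst, if_pos h3, h3, hst, zz_add, Finsupp.add_apply, Finsupp.single_eq_same]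
      have : ((e : ℕ) : ℂ) = i + 1 := by simp [he]
      rw [this]
      push_cast
      ring
    · rw [if_neg hst]
      by_cases h0 : s e = 0
      · rw [h0]; simp
      · rw [if_neg]
        · simp
        · intro h4
          apply hst
          rw [← h4, tsub_add_cancel_of_le]
          simpa using Nat.one_le_iff_ne_zero.mpr h0

lemma B_const {B : PolyT →ₗ[ℂ] PolyT →ₗ[ℂ] ℂ} (hB : IsForm B) (f : PolyT) (c : ℂ) :
    B f (C c) = constantCoeff f * c := by
  have h0 : (C c : PolyT) = c • monomial 0 1 := by rw [smul_monomial, smul_eq_mul, mul_one]; rfl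
  rw [h0, map_smul, smul_eq_mul, mul_comm]
  congr 1
  induction f using MvPolynomial.induction_on' with
  | add p q hp hq => simp only [map_add, LinearMap.add_apply, hp, hq]
  | monomial s a =>
    have ha : (monomial s a : PolyT) = a • monomial s 1 := by
      rw [smul_monomial, smul_eq_mul, mul_one]
    rw [ha, map_smul, LinearMap.smul_apply, B_mono hB, constantCoeff_smul, constantCoeff_eq, coeff_monomial]
    by_cases h : s = 0
    · subst h; simp [zz]
    · simp [h]

lemma deriv_sum_apply (S : Finset ℕ) (D : ℕ → Derivation ℂ PolyT PolyT) (g : PolyT) :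
    (∑ i ∈ S, D i) g = ∑ i ∈ S, D i g := by
  classical
  induction S using Finset.induction_on with
  | empty => simp
  | insert a s ha ih => rw [Finset.sum_insert ha, Finset.sum_insert ha, Derivation.add_apply, ih]

lemma B_euler {B : PolyT →ₗ[ℂ] PolyT →ₗ[ℂ] ℂ} (hB : IsForm B) (f g : PolyT) :
    ∃ M0 : ℕ, ∀ M, M0 ≤ M → B f (EE g) = ∑ i ∈ Finset.range M, B (DD i f) (DD i g) := by
  classical
  refine ⟨g.vars.sup (fun i => (i : ℕ)) + 1, fun M hM => ?_⟩
  have h : EE g = (∑ i ∈ Finset.range M, (X (Nat.succPNat i) : PolyT) • DD i : Derivation ℂ PolyT PolyT) g := by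
    apply derivation_eq_of_forall_mem_vars
    intro j hj
    have hj' := Finset.le_sup (f := fun i : ℕ+ => (i : ℕ)) hj
    rw [deriv_sum_apply, Finset.sum_eq_single (PNat.natPred j)]
    · rw [EE, mkDerivation_X, Derivation.smul_apply, DD, Derivation.smul_apply, PNat.succPNat_natPred, pderiv_X_self]
      rw [smul_eq_mul, mul_smul_comm, mul_one]
      congr 1
      exact_mod_cast (PNat.natPred_add_one j).symm
    · intro i _ hi
      have : j ≠ Nat.succPNat i := by
        rintro rfl; apply hi; simp
      rw [Derivation.smul_apply, DD, Derivation.smul_apply, pderiv_X_of_ne this]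
      simp
    · intro hn
      exfalso; apply hn
      rw [Finset.mem_range]
      have := PNat.natPred_add_one j
      omega
  rw [h, deriv_sum_apply, map_sum]
  refine Finset.sum_congr rfl fun i _ => ?_
  rw [Derivation.smul_apply, smul_eq_mul, B_adj hB]

end form

lemma dg_inj {N : ℕ} (l : Fin N → ℤ) (hi : Function.Injective l) (h0 : ∀ r, 0 ≤ l r) :
    0 ≤ dg l ∧ (dg l = 0 → ∀ r, l r < N) := by
  classical
  set S : Finset ℤ := Finset.univ.image l with hS
  have hj : Function.Injective (fun r : Fin N => ((r : ℕ) : ℤ)) := by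
    intro a b h
    simp only [Nat.cast_inj] at h
    exact Fin.ext h
  set R : Finset ℤ := Finset.univ.image (fun r : Fin N => ((r : ℕ) : ℤ)) with hR
  have cS : S.card = N := by rw [hS, Finset.card_image_of_injective _ hi]; simp
  have cR : R.card = N := by rw [hR, Finset.card_image_of_injective _ hj]; simp
  have sS : ∑ x ∈ S, x = ∑ r, l r := by rw [hS, Finset.sum_image (fun a _ b _ h => hi h)]
  have sR : ∑ x ∈ R, x = ∑ r : Fin N, ((r : ℕ) : ℤ) := by rw [hR, Finset.sum_image (fun a _ b _ h => hj h)]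
  have hd : dg l = ∑ x ∈ S \ R, x - ∑ x ∈ R \ S, x := by
    rw [Finset.sum_sdiff_sub_sum_sdiff, sS, sR]; rfl
  have hc : (S \ R).card = (R \ S).card := Finset.card_sdiff_comm (by rw [cS, cR])
  have mR : ∀ x : ℤ, 0 ≤ x → x < N → x ∈ R := by
    intro x h1 h2
    rw [hR, Finset.mem_image]
    exact ⟨⟨x.toNat, by omega⟩, Finset.mem_univ _, by simp; omega⟩
  have b1 : (S \ R).card • (N : ℤ) ≤ ∑ x ∈ S \ R, x := by
    apply Finset.card_nsmul_le_sum
    intro x hx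
    rw [Finset.mem_sdiff] at hx
    by_contra hlt
    apply hx.2
    obtain ⟨r, _, rfl⟩ := Finset.mem_image.mp hx.1
    exact mR _ (h0 r) (by omega)
  have b2 : ∑ x ∈ R \ S, x ≤ (R \ S).card • ((N : ℤ) - 1) := by
    apply Finset.sum_le_card_nsmul
    intro x hx
    rw [Finset.mem_sdiff] at hx
    obtain ⟨r, _, rfl⟩ := Finset.mem_image.mp hx.1
    have := r.2
    omega
  rw [hc] at b1
  simp only [nsmul_eq_mul] at b1 b2
  have b3 : ((R \ S).card : ℤ) ≤ dg l := by rw [hd]; linarith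
  refine ⟨by omega, fun hz r => ?_⟩
  have hz2 : (S \ R).card = 0 := by omega
  rw [Finset.card_eq_zero, Finset.sdiff_eq_empty_iff_subset] at hz2
  have := hz2 (Finset.mem_image_of_mem l (Finset.mem_univ r))
  obtain ⟨q, _, hq⟩ := Finset.mem_image.mp this
  have := q.2
  omega

lemma GG_ne {N : ℕ} (l l' : Fin N → ℤ) (h : GG l l' ≠ 0) : ∃ σ : Equiv.Perm (Fin N), ∀ r, l r = l' (σ r) := by
  unfold GG at h
  obtain ⟨σ, _, hσ⟩ := Finset.exists_ne_zero_of_sum_ne_zero h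
  refine ⟨σ, fun r => ?_⟩
  have := Finset.prod_ne_zero_iff.mp (right_ne_zero_of_mul hσ) r (Finset.mem_univ r)
  unfold dl at this
  by_contra hc
  apply this
  rw [if_neg (by tauto)]

lemma GG_good {N : ℕ} (l l' : Fin N → ℤ) (h : GG l l' ≠ 0) : Function.Injective l' ∧ ∀ t, 0 ≤ l' t := by
  rw [GG_det] at h
  constructor
  · intro a b hab
    by_contra hne
    apply h
    apply Matrix.det_zero_of_column_eq hne
    intro k
    simp [hab]
  · intro t
    by_contra hc
    apply h
    apply Matrix.det_eq_zero_of_column_eq_zero t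
    intro i
    simp only [Matrix.of_apply, dl]
    rw [if_neg (by omega)]

lemma base_GG {N : ℕ} (l l' : Fin N → ℤ) (h : dg l' = 0) :
    constantCoeff (SS l) * constantCoeff (SS l') = GG l l' := by
  have e : constantCoeff (SS l) * constantCoeff (SS l') =
      (Matrix.of fun r t : Fin N => if l r = l' t ∧ 0 ≤ l r ∧ l' t < N then (1 : ℂ) else 0).det := by
    rw [constCoeff_SS, constCoeff_SS, ← Matrix.det_transpose (Matrix.of fun r j : Fin N => if l' r - ((N : ℤ) - 1) + (j : ℕ) = 0 then (1 : ℂ) else 0), ← Matrix.det_mul]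
    congr 1
    ext r t
    rw [Matrix.mul_apply]
    simp only [Matrix.of_apply, Matrix.transpose_apply]
    split_ifs with hh
    · rw [Finset.sum_eq_single (⟨((N : ℤ) - 1 - l r).toNat, by omega⟩ : Fin N)]
      · simp only
        rw [if_pos (by omega), if_pos (by omega), mul_one]
      · intro j _ hj
        rw [if_neg, zero_mul]
        intro hz
        apply hj
        apply Fin.ext
        simp only
        omega
      · intro hn; exact absurd (Finset.mem_univ _) hn
    · refine Finset.sum_eq_zero fun j _ => ?_
      have := j.2
      by_cases h1 : l r - ((N : ℤ) - 1) + (j : ℕ) = 0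
      · rw [if_neg (c := l' t - ((N : ℤ) - 1) + (j : ℕ) = 0) (by omega), mul_zero]
      · rw [if_neg h1, zero_mul]
  rw [e]
  by_cases hi : Function.Injective l'
  · by_cases h0 : ∀ t, 0 ≤ l' t
    · have hlt := (dg_inj l' hi h0).2 h
      rw [GG_det]
      congr 1
      ext r t
      simp only [Matrix.of_apply, dl]
      congr 1
      have := hlt t
      apply propext
      constructor
      · rintro ⟨a, b, c⟩; exact ⟨a, b⟩
      · rintro ⟨a, b⟩; exact ⟨a, b, this⟩
    · have : GG l l' = 0 := by
        by_contra hc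
        exact h0 (GG_good l l' hc).2
      rw [this]
      push Not at h0
      obtain ⟨t, ht⟩ := h0
      apply Matrix.det_eq_zero_of_column_eq_zero t
      intro i
      simp only [Matrix.of_apply]
      rw [if_neg (by omega)]
  · have : GG l l' = 0 := by
      by_contra hc
      exact hi (GG_good l l' hc).1
    rw [this]
    rw [Function.Injective] at hi
    push Not at hi
    obtain ⟨a, b, hab, hne⟩ := hi
    apply Matrix.det_zero_of_column_eq hne
    intro k
    simp [hab]

lemma dg_update {N : ℕ} (l : Fin N → ℤ) (r : Fin N) (a : ℤ) : dg (Function.update l r a) = dg l - l r + a := by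
  unfold dg
  rw [Finset.sum_update_of_mem (Finset.mem_univ r), ← Finset.add_sum_erase Finset.univ l (Finset.mem_univ r),
    Finset.sdiff_singleton_eq_erase]
  ring

lemma B_sum_sum (B : PolyT →ₗ[ℂ] PolyT →ₗ[ℂ] ℂ) {N : ℕ} (f g : Fin N → PolyT) :
    B (∑ r, f r) (∑ t, g t) = ∑ r, ∑ t, B (f r) (g t) := by
  rw [map_sum B, LinearMap.sum_apply]
  refine Finset.sum_congr rfl fun r _ => ?_
  rw [map_sum]

theorem ortho {B : PolyT →ₗ[ℂ] PolyT →ₗ[ℂ] ℂ} (hB : IsForm B) {N : ℕ} (n : ℕ) :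
    ∀ l l' : Fin N → ℤ, dg l' < n → B (SS l) (SS l') = GG l l' := by
  induction n with
  | zero =>
    intro l l' h
    rw [SS_neg l' (by exact_mod_cast h), map_zero]
    by_contra hc
    have := GG_good l l' (Ne.symm hc)
    have := (dg_inj l' this.1 this.2).1
    push_cast at h
    omega
  | succ n ih =>
    intro l l' h
    by_cases hlt : dg l' < n
    · exact ih l l' hlt
    have hn : dg l' = n := by push_cast at h; omega
    rcases Nat.eq_zero_or_pos n with h0 | hpos
    · have h0' : dg l' = 0 := by rw [hn, h0]; rfl
      rw [SS_const l' h0', B_const hB, base_GG l l' h0']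
    · obtain ⟨M0, hM0⟩ := B_euler hB (SS l) (SS l')
      obtain ⟨M1, hM1⟩ : ∃ M1 : ℕ, ∀ r, l r ≤ M1 := by
        refine ⟨Finset.univ.sup (fun r => (l r).toNat), fun r => ?_⟩
        have := Finset.le_sup (f := fun r => (l r).toNat) (Finset.mem_univ r)
        omega
      have e1 := hM0 (max M0 M1) (le_max_left _ _)
      have e2 := GG_rec l l' (max M0 M1) (fun r => (hM1 r).trans (by exact_mod_cast le_max_right _ _))
      rw [EE_SS, map_smul, smul_eq_mul] at e1
      have e3 : ∀ i ∈ Finset.range (max M0 M1), B (DD i (SS l)) (DD i (SS l')) = ∑ r, ∑ t, GG (Function.update l r (l r - (i + 1)))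
          (Function.update l' t (l' t - (i + 1))) := by
        intro i _
        rw [DD_SS, DD_SS, B_sum_sum]
        refine Finset.sum_congr rfl fun r _ => ?_
        refine Finset.sum_congr rfl fun t _ => ?_
        apply ih
        rw [dg_update]
        omega
      rw [Finset.sum_congr rfl e3, e2] at e1
      have e4 : (dg l : ℂ) * GG l l' = (dg l' : ℂ) * GG l l' := by
        by_cases hg : GG l l' = 0
        · rw [hg]; simp
        · obtain ⟨σ, hσ⟩ := GG_ne l l' hg
          congr 2
          unfold dg
          rw [Finset.sum_congr rfl fun r _ => hσ r, Equiv.sum_comp σ l']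
      rw [e4] at e1
      refine mul_left_cancel₀ ?_ e1
      rw [hn]
      exact_mod_cast hpos.ne'


lemma nz_finite (lam : Ptn) : {i : ℕ | lam.parts i ≠ 0}.Finite := by
  obtain ⟨N, hN⟩ := lam.eventually_zero
  refine (Set.finite_Iio N).subset fun i hi => ?_
  by_contra hc
  exact hi (hN i (by simpa using hc))

lemma parts_zero (lam : Ptn) (i : ℕ) (h : lam.len ≤ i) : lam.parts i = 0 := by
  by_contra hc
  have h1 : ((Finset.range (i+1) : Finset ℕ) : Set ℕ) ⊆ {i : ℕ | lam.parts i ≠ 0} := by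
    intro j hj
    simp only [Finset.coe_range, Set.mem_Iio] at hj
    have := lam.antitone (show j ≤ i by omega)
    simp only [Set.mem_setOf_eq]
    omega
  have h2 := Set.ncard_le_ncard h1 (nz_finite lam)
  rw [Set.ncard_coe_finset, Finset.card_range] at h2
  unfold Ptn.len at h
  omega

/-- Jacobi-Trudi of size n -/
def JT (lam : Ptn) (n : ℕ) : PolyT :=
  (Matrix.of fun i j : Fin n =>
    hsymZ ((lam.parts i : ℤ) - ((i : ℕ) + 1) + ((j : ℕ) + 1))).det

lemma JT_succ (lam : Ptn) (n : ℕ) (h : lam.parts n = 0) : JT lam (n+1) = JT lam n := by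
  unfold JT
  rw [Matrix.det_succ_row _ (Fin.last n), Fin.sum_univ_castSucc]
  rw [Finset.sum_eq_zero, zero_add]
  · simp only [Fin.val_last, Fin.succAbove_last, Matrix.of_apply, h]
    have : hsymZ (((0 : ℕ) : ℤ) - ((n : ℤ) + 1) + ((n : ℤ) + 1)) = 1 := by
      have : (((0 : ℕ) : ℤ) - ((n : ℤ) + 1) + ((n : ℤ) + 1)) = 0 := by push_cast; ring
      rw [this]; simp [hsymZ, hsym_zero]
    rw [this, ← two_mul, pow_mul, neg_one_sq, one_pow, one_mul, one_mul]
    congr 1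
  · intro j _
    simp only [Matrix.of_apply, Fin.val_last, Fin.val_castSucc, h]
    have : hsymZ (((0 : ℕ) : ℤ) - ((n : ℤ) + 1) + (((j : ℕ) : ℤ) + 1)) = 0 := by
      have := j.2
      rw [hsymZ, if_neg (by omega)]
    rw [this]; simp

lemma JT_eq (lam : Ptn) (N : ℕ) (h : lam.len ≤ N) : schur lam = JT lam N := by
  induction N, h using Nat.le_induction with
  | base => rfl
  | succ n hn ih => rw [ih, JT_succ lam n (parts_zero lam n hn)]

def ll (lam : Ptn) (N : ℕ) (r : Fin N) : ℤ := (lam.parts r : ℤ) - ((r : ℕ) + 1) + N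

lemma schur_SS (lam : Ptn) (N : ℕ) (h : lam.len ≤ N) : schur lam = SS (ll lam N) := by
  rw [JT_eq lam N h, JT, ← Matrix.det_transpose, Matrix.det_apply', SS]
  refine Finset.sum_congr rfl fun σ _ => ?_
  rw [Algebra.smul_def]
  congr 1
  · simp only [Matrix.transpose_apply, Matrix.of_apply, ll]
    refine Finset.prod_congr rfl fun r _ => ?_
    congr 1
    ring

lemma wt_eq (lam : Ptn) (N : ℕ) (h : lam.len ≤ N) : (lam.wt : ℚ) = ∑ r : Fin N, (lam.parts r : ℚ) := by
  unfold Ptn.wt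
  rw [finsum_eq_sum_of_support_subset (s := Finset.range N), Nat.cast_sum, Finset.sum_range]
  intro i hi
  by_contra hc
  simp only [Finset.coe_range, Set.mem_Iio, not_lt] at hc
  exact hi (parts_zero lam i (h.trans hc))

lemma Pfn_eq (lam : Ptn) (N : ℕ) (h : lam.len ≤ N) : Pfn 2 lam =
    ∑ r : Fin N, (((lam.parts r : ℚ) - (((r : ℕ) : ℚ) + 1) + 1 / 2) ^ 2 - (-(((r : ℕ) : ℚ) + 1) + 1 / 2) ^ 2) := by
  unfold Pfn
  rw [finsum_eq_sum_of_support_subset (s := Finset.range N), Finset.sum_range]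
  intro i hi
  by_contra hc
  simp only [Finset.coe_range, Set.mem_Iio, not_lt] at hc
  apply hi
  simp only [parts_zero lam i (h.trans hc)]
  push_cast
  ring

lemma sq_eq (lam : Ptn) (N : ℕ) (h : lam.len ≤ N) : ((∑ r, (ll lam N r) ^ 2 : ℤ) : ℚ) =
    Pfn 2 lam + (2 * (N : ℚ) - 1) * lam.wt + ∑ r : Fin N, ((N : ℚ) - ((r : ℕ) + 1)) ^ 2 := by
  rw [Pfn_eq lam N h, wt_eq lam N h, Finset.mul_sum, ← Finset.sum_add_distrib, ← Finset.sum_add_distrib]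
  push_cast
  refine Finset.sum_congr rfl fun r _ => ?_
  unfold ll
  push_cast
  ring

lemma ll_anti (lam : Ptn) (N : ℕ) : StrictAnti (ll lam N) := by
  intro a b hab
  have h1 : (a : ℕ) < b := hab
  have := lam.antitone h1.le
  unfold ll
  omega

lemma sum_update_f {N : ℕ} (l : Fin N → ℤ) (r : Fin N) (a : ℤ) (f : ℤ → ℤ) :
    ∑ x, f (Function.update l r a x) = ∑ x, f (l x) - f (l r) + f a := by
  rw [← Finset.add_sum_erase _ _ (Finset.mem_univ r), ← Finset.add_sum_erase _ (fun x => f (l x)) (Finset.mem_univ r),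
    Function.update_self, Finset.sum_congr rfl fun x hx => by rw [Function.update_of_ne (Finset.ne_of_mem_erase hx)]]
  ring

lemma combi {N : ℕ} (l l' : Fin N → ℤ) (hl : StrictAnti l) (hl' : StrictAnti l')
    (hsq : ∑ r, l r ^ 2 = ∑ r, l' r ^ 2) (r t : Fin N) (i : ℕ)
    (h : GG (Function.update l r (l r - (i + 1))) (Function.update l' t (l' t - (i + 1))) ≠ 0) : l = l' := by
  obtain ⟨σ, hσ⟩ := GG_ne _ _ h
  have key : ∀ f : ℤ → ℤ, ∑ x, f (l x) - f (l r) + f (l r - (i + 1)) =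
      ∑ x, f (l' x) - f (l' t) + f (l' t - (i + 1)) := by
    intro f
    rw [← sum_update_f, ← sum_update_f, Finset.sum_congr rfl fun x _ => by rw [hσ x]]
    exact Equiv.sum_comp σ (fun x => f (Function.update l' t (l' t - (i + 1)) x))
  have h1 : l r = l' t := by
    have := key (fun x => x ^ 2)
    simp only [hsq] at this
    have h2 : ((i : ℤ) + 1) * (l r - l' t) = 0 := by linarith
    rcases mul_eq_zero.mp h2 with h3 | h3
    · omega
    · omega
  have h2 : ∀ f : ℤ → ℤ, ∑ x, f (l x) = ∑ x, f (l' x) := by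
    intro f
    have := key f
    rw [h1] at this
    omega
  have hcount : ∀ (g : Fin N → ℤ) (v : ℤ), v ∈ Set.range g ↔ (∑ x, if g x = v then (1 : ℤ) else 0) ≠ 0 := by
    intro g v
    rw [Finset.sum_boole, Nat.cast_ne_zero, Finset.card_ne_zero, Set.mem_range]
    constructor
    · rintro ⟨x, hx⟩; exact ⟨x, by simpa using hx⟩
    · rintro ⟨x, hx⟩; exact ⟨x, by simpa using hx⟩
  have hr : Set.range l = Set.range l' := by
    ext v
    rw [hcount, hcount, h2 (fun y => if y = v then 1 else 0)]
  exact (hl.range_inj hl').mp hr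

lemma main_zero {B : PolyT →ₗ[ℂ] PolyT →ₗ[ℂ] ℂ} (hB : IsForm B) (lam mu : Ptn) (hwt : lam.wt = mu.wt)
    (hne : lam ≠ mu) (hP : Pfn 2 lam = Pfn 2 mu) (i : ℕ) : B (DD i (schur lam)) (DD i (schur mu)) = 0 := by
  set N := max lam.len mu.len with hN
  have h1 : lam.len ≤ N := le_max_left _ _
  have h2 : mu.len ≤ N := le_max_right _ _
  rw [schur_SS lam N h1, schur_SS mu N h2, DD_SS, DD_SS, B_sum_sum]
  refine Finset.sum_eq_zero fun r _ => ?_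
  refine Finset.sum_eq_zero fun t _ => ?_
  obtain ⟨n, hn⟩ : ∃ n : ℕ, dg (Function.update (ll mu N) t (ll mu N t - (i + 1))) < n :=
    ⟨(dg (Function.update (ll mu N) t (ll mu N t - (i + 1)))).toNat + 1, by omega⟩
  rw [ortho hB n _ _ hn]
  by_contra hc
  apply hne
  have hsq : ∑ r, (ll lam N r) ^ 2 = ∑ r, (ll mu N r) ^ 2 := by
    have a1 := sq_eq lam N h1
    have a2 := sq_eq mu N h2
    rw [hP, hwt, ← a2] at a1
    exact_mod_cast a1
  have heq := combi _ _ (ll_anti lam N) (ll_anti mu N) hsq r t i hc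
  have hp : lam.parts = mu.parts := by
    funext j
    by_cases hj : j < N
    · have := congrFun heq ⟨j, hj⟩
      simp only [ll] at this
      omega
    · rw [parts_zero lam j (by omega), parts_zero mu j (by omega)]
  cases lam; cases mu
  simp only at hp
  subst hp
  rfl

end S9

open Classical in
/-- If `λ ≠ μ` are distinct partitions of the same weight `k ≥ 1` with
`P_2(λ) = P_2(μ)`, then `⟨ s_λ(T), Σ_{i≥1} i³ T_i ∂s_μ(T)/∂T_i ⟩ = 0`, where
`⟨·,·⟩` is the bilinear form with `⟨T_ν, T_ρ⟩ = z_ν δ_{ν,ρ}`. -/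
theorem statement9 (k : ℕ) (hk : 1 ≤ k) (lam mu : Ptn)
    (hlam : lam.wt = k) (hmu : mu.wt = k) (hne : lam ≠ mu)
    (hP : Pfn 2 lam = Pfn 2 mu)
    (B : MvPolynomial ℕ+ ℂ →ₗ[ℂ] MvPolynomial ℕ+ ℂ →ₗ[ℂ] ℂ)
    (hB : ∀ nu rho : Ptn,
      B (Tmon nu) (Tmon rho) = if nu = rho then ((zPart nu : ℕ) : ℂ) else 0) :
    B (schur lam) (∑ᶠ i : ℕ+, (((i : ℕ) : ℂ) ^ 3) • (X i * pderiv i (schur mu))) = 0 := by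
  have hB' : IsForm B := hB
  refine finsum_induction (fun p => B (schur lam) p = 0) (map_zero _) ?_ ?_
  · intro x y hx hy
    rw [map_add, hx, hy, add_zero]
  · intro i
    have hi : i = Nat.succPNat (PNat.natPred i) := (PNat.succPNat_natPred i).symm
    generalize PNat.natPred i = n at hi
    subst hi
    have h0 : ((n : ℂ) + 1) ≠ 0 := by exact_mod_cast Nat.succ_ne_zero n
    have h1 : pderiv (Nat.succPNat n) (schur mu) = ((n : ℂ) + 1)⁻¹ • DD n (schur mu) := by
      rw [DD, Derivation.smul_apply, smul_smul, inv_mul_cancel₀ h0, one_smul]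
    rw [h1, mul_smul_comm, map_smul, map_smul, B_adj hB', main_zero hB' lam mu (hlam.trans hmu.symm) hne hP]
    simp
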